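/- Let (Q,P) be a weakly quasi-lattice ordered group and let Λ be a P-graph with FA(Λ) ≠ ∅. For any triple g = (y,q,z) ∈ PS(Λ) × Q × PS(Λ), the following are equivalent: (1) there exist m,n ∈ P with q = mn⁻¹, y ∈ D_m, z ∈ D_n and y·m = z·n; (2) there exist x ∈ PS(Λ) and μ,ν ∈ Λ with s(μ) = s(ν) = r(x) such that g = (μ·x, d(μ)d(ν)⁻¹, ν·x). -/

import Mathlib

set_option autoImplicit false

/-- The topology on the power set `Set α` obtained by identifying it with the
product `∏ _ : α, Prop` where each (two-point) factor `Prop` carries the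
discrete topology. -/
instance powersetTopology (α : Type) : TopologicalSpace (Set α) :=
  @Pi.topologicalSpace α (fun _ => Prop) (fun _ => ⊥)

/-- The cylinder `Z(K₁;K₂) = {x : K₁ ⊆ x ⊆ K₂ᶜ}`. -/
def cylinder {α : Type} (K₁ K₂ : Set α) : Set (Set α) :=
  {x | K₁ ⊆ x ∧ x ⊆ K₂ᶜ}

/-- The relation `p ≤ r` iff `p * q = r` for some `q ∈ P`. -/
def Submonoid.leftLE {Q : Type} [Group Q] (P : Submonoid Q) (p r : Q) : Prop :=
  ∃ q ∈ P, p * q = r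

/-- A weakly quasi-lattice ordered group `(Q,P)`: a group `Q` together with a
subsemigroup `P` containing the unit with `P ∩ P⁻¹ = {e}`, such that any two
elements of `P` with a common upper bound (for `leftLE`) have a least common
upper bound. -/
structure WQLO (Q : Type) [Group Q] where
  P : Submonoid Q
  inter_inv : ∀ p ∈ P, p⁻¹ ∈ P → p = 1
  lub : ∀ a ∈ P, ∀ b ∈ P, (∃ c ∈ P, P.leftLE a c ∧ P.leftLE b c) →
    ∃ l ∈ P, P.leftLE a l ∧ P.leftLE b l ∧
      ∀ c ∈ P, P.leftLE a c → P.leftLE b c → P.leftLE l c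

/-- A (discrete) `P`-graph: a countable small category, presented by its set of
morphisms `Λ` with range map `r`, source map `s` and a composition `mul`
(constrained by the axioms only on composable pairs, i.e. when `s μ = r ν`),
together with a degree functor `d : Λ → P` satisfying the unique factorisation
property. The units of `Λ` are exactly the elements of the form `r lam`. -/
structure PGraph (Q : Type) [Group Q] (W : WQLO Q) where
  Λ : Type
  countable : Countable Λ
  r : Λ → Λ
  s : Λ → Λ
  mul : Λ → Λ → Λ
  d : Λ → Q
  d_mem : ∀ lam, d lam ∈ W.P
  s_r : ∀ lam, s (r lam) = r lam
  r_r : ∀ lam, r (r lam) = r lam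
  s_s : ∀ lam, s (s lam) = s lam
  r_s : ∀ lam, r (s lam) = s lam
  id_mul : ∀ lam, mul (r lam) lam = lam
  mul_id : ∀ lam, mul lam (s lam) = lam
  r_mul : ∀ mu nu, s mu = r nu → r (mul mu nu) = r mu
  s_mul : ∀ mu nu, s mu = r nu → s (mul mu nu) = s nu
  mul_assoc : ∀ mu nu k, s mu = r nu → s nu = r k →
    mul (mul mu nu) k = mul mu (mul nu k)
  d_unit : ∀ lam, d (r lam) = 1
  d_mul : ∀ mu nu, s mu = r nu → d (mul mu nu) = d mu * d nu
  factor : ∀ lam, ∀ p ∈ W.P, ∀ q ∈ W.P, d lam = p * q →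
    ∃! mn : Λ × Λ, s mn.1 = r mn.2 ∧ mul mn.1 mn.2 = lam ∧ d mn.1 = p ∧ d mn.2 = q

namespace PGraph

variable {Q : Type} [Group Q] {W : WQLO Q} (G : PGraph Q W)

/-- `λΛ = {λμ : μ ∈ Λ, s λ = r μ}`. -/
def cone (lam : G.Λ) : Set G.Λ :=
  {x | ∃ mu, G.s lam = G.r mu ∧ x = G.mul lam mu}

/-- `λE = {λμ : μ ∈ E, s λ = r μ}`. -/
def coneSet (lam : G.Λ) (E : Set G.Λ) : Set G.Λ :=
  {x | ∃ mu ∈ E, G.s lam = G.r mu ∧ x = G.mul lam mu}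

/-- `Λ` is finitely aligned at the pair `(μ,ν)`. -/
def FinAlignedAtPair (mu nu : G.Λ) : Prop :=
  ∃ J : Finset G.Λ, G.cone mu ∩ G.cone nu = ⋃ lam ∈ (J : Set G.Λ), G.cone lam

/-- `Λ` is finitely aligned at `λ`. -/
def FinAlignedAt (lam : G.Λ) : Prop :=
  ∀ mu ∈ G.cone lam, ∀ nu : G.Λ, G.FinAlignedAtPair mu nu

/-- The finitely aligned part `FA(Λ)`. -/
def FA : Set G.Λ := {lam | G.FinAlignedAt lam}

/-- `FAr(Λ) = FA(Λ) ∪ r(FA(Λ))`. -/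
def FAr : Set G.Λ := G.FA ∪ G.r '' G.FA

/-- `μ ≼ λ` iff `μν = λ` for some `ν`. -/
def pre (mu lam : G.Λ) : Prop :=
  ∃ nu, G.s mu = G.r nu ∧ G.mul mu nu = lam

/-- A filter: a nonempty, hereditary and directed subset of `Λ`. -/
def IsFilter (x : Set G.Λ) : Prop :=
  x.Nonempty ∧ (∀ lam mu, G.pre lam mu → mu ∈ x → lam ∈ x) ∧
    ∀ mu ∈ x, ∀ nu ∈ x, ∃ lam ∈ x, G.pre mu lam ∧ G.pre nu lam

/-- The space `ℱΛ` of filters, with the subspace topology from `𝒫(Λ)`. -/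
abbrev FilterSpace := {x : Set G.Λ // G.IsFilter x}

/-- `Z_{ℱΛ}(μ;K) = {x ∈ ℱΛ : μ ∈ x ⊆ Λ∖K}`. -/
def Zf (mu : G.Λ) (K : Set G.Λ) : Set G.FilterSpace :=
  {x | mu ∈ x.1 ∧ x.1 ⊆ Kᶜ}

/-- An ultrafilter: a filter maximal with respect to inclusion. -/
def IsUltrafilter (x : Set G.Λ) : Prop :=
  G.IsFilter x ∧ ∀ y, G.IsFilter y → x ⊆ y → x = y

/-- The path space `PS(Λ)`: filters meeting `FA(Λ)` (as a set of subsets). -/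
def PS : Set (Set G.Λ) := {x | G.IsFilter x ∧ (x ∩ G.FA).Nonempty}

/-- The path space as a topological space (subspace of `𝒫(Λ)`). -/
abbrev PSpace := {x : Set G.Λ // x ∈ G.PS}

/-- The boundary-path space: the closure in `PS(Λ)` of the set of ultrafilters
lying in `PS(Λ)`. -/
def BPS : Set G.PSpace := closure {x : G.PSpace | G.IsUltrafilter x.1}

abbrev BPSpace := {x : G.PSpace // x ∈ G.BPS}

/-- The left shift `λ⁻¹·x = {μ : λμ ∈ x}`. -/
def lshift (lam : G.Λ) (x : Set G.Λ) : Set G.Λ :=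
  {mu | G.s lam = G.r mu ∧ G.mul lam mu ∈ x}

/-- The right shift `λ·x = {ζ : ζ ≼ λμ for some μ ∈ x}`. -/
def rshift (lam : G.Λ) (x : Set G.Λ) : Set G.Λ :=
  {z | ∃ mu ∈ x, G.s lam = G.r mu ∧ G.pre z (G.mul lam mu)}

/-- The action `x·m`: the left shift of `x` by the unique element of
`x ∩ Λ^m` (when it exists). -/
def act (x : Set G.Λ) (m : Q) : Set G.Λ :=
  ⋃ lam ∈ {l ∈ x | G.d l = m}, G.lshift lam x

/-- The domain `D_m = {x ∈ PS(Λ) : x ∩ Λ^m ≠ ∅}` of `T_m`. -/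
def Dom (m : Q) : Set (Set G.Λ) := {x ∈ G.PS | ∃ l ∈ x, G.d l = m}

/-- The range `R_m = {x·m : x ∈ D_m}` of `T_m`. -/
def Ran (m : Q) : Set (Set G.Λ) := {y | ∃ x ∈ G.Dom m, G.act x m = y}

end PGraph

namespace PGraph

variable {Q : Type} [Group Q] {W : WQLO Q} (G : PGraph Q W)

/-- Two factorisations of the same path with initial segments of equal degree coincide. -/
theorem factorisation_unique {a b a' b' : G.Λ} (h : G.s a = G.r b) (h' : G.s a' = G.r b')
    (hm : G.mul a b = G.mul a' b') (hd : G.d a = G.d a') : a = a' ∧ b = b' := by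
  have h1 := G.d_mul a b h
  have h2 := G.d_mul a' b' h'
  have hb : G.d b' = G.d b := by
    rw [← hm, h1, hd] at h2
    exact (mul_left_cancel h2).symm
  have := (G.factor _ _ (G.d_mem a) _ (G.d_mem b) h1).unique
    (y₁ := (a, b)) (y₂ := (a', b')) ⟨h, rfl, rfl, rfl⟩ ⟨h', hm.symm, hd.symm, hb⟩
  exact Prod.ext_iff.mp this

theorem mul_left_cancel_of_composable {a b b' : G.Λ} (h : G.s a = G.r b) (h' : G.s a = G.r b')
    (hm : G.mul a b = G.mul a b') : b = b' :=
  (G.factorisation_unique h h' hm rfl).2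

theorem pre_trans {a b c : G.Λ} (hab : G.pre a b) (hbc : G.pre b c) : G.pre a c := by
  obtain ⟨k, hk, rfl⟩ := hab
  obtain ⟨l, hl, rfl⟩ := hbc
  rw [G.s_mul _ _ hk] at hl
  exact ⟨G.mul k l, by rw [G.r_mul _ _ hl, hk], (G.mul_assoc _ _ _ hk hl).symm⟩

theorem r_eq_of_pre {a b : G.Λ} (h : G.pre a b) : G.r a = G.r b := by
  obtain ⟨k, hk, rfl⟩ := h
  exact (G.r_mul _ _ hk).symm

theorem mem_cone_iff_pre {a b : G.Λ} : b ∈ G.cone a ↔ G.pre a b := by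
  simp only [cone, pre, Set.mem_ofPred_eq, eq_comm]

/-- Left multiplication by a composable path preserves and reflects `≼`. -/
theorem pre_mul_left_iff {a b c : G.Λ} (hb : G.s a = G.r b) (hc : G.s a = G.r c) :
    G.pre (G.mul a b) (G.mul a c) ↔ G.pre b c := by
  constructor
  · rintro ⟨k, hk, hm⟩
    rw [G.s_mul _ _ hb] at hk
    rw [G.mul_assoc _ _ _ hb hk] at hm
    exact ⟨k, hk, G.mul_left_cancel_of_composable (by rw [G.r_mul _ _ hk, hb]) hc hm⟩
  · rintro ⟨k, hk, rfl⟩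
    exact ⟨k, by rw [G.s_mul _ _ hb, hk], G.mul_assoc _ _ _ hb hk⟩

theorem FinAlignedAt.of_pre {a b : G.Λ} (ha : G.FinAlignedAt a) (h : G.pre a b) :
    G.FinAlignedAt b := fun c hc e =>
  ha c (G.mem_cone_iff_pre.2 (G.pre_trans h (G.mem_cone_iff_pre.1 hc))) e

theorem FinAlignedAt.of_mul_left {a b : G.Λ} (hab : G.s a = G.r b)
    (h : G.FinAlignedAt (G.mul a b)) : G.FinAlignedAt b := by
  classical
  intro c hc e
  rw [mem_cone_iff_pre] at hc
  have hac : G.s a = G.r c := hab.trans (G.r_eq_of_pre hc)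
  by_cases hae : G.s a = G.r e
  · obtain ⟨J, hJ⟩ := h (G.mul a c)
      (G.mem_cone_iff_pre.2 ((G.pre_mul_left_iff hab hac).2 hc)) (G.mul a e)
    have key : ∀ t, (G.pre (G.mul a c) t ∧ G.pre (G.mul a e) t) ↔ ∃ j ∈ J, G.pre j t := by
      intro t
      have := Set.ext_iff.1 hJ t
      simpa [mem_cone_iff_pre] using this
    have hfac : ∀ j ∈ J, ∃ k, G.s a = G.r k ∧ G.mul a k = j := by
      intro j hj
      have := ((key j).2 ⟨j, hj, G.s j, (G.r_s j).symm, G.mul_id j⟩).1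
      exact G.pre_trans ⟨c, hac, rfl⟩ this
    choose! f hf hfm using hfac
    refine ⟨J.image f, Set.ext fun t => ?_⟩
    simp only [Set.mem_inter_iff, mem_cone_iff_pre, Finset.coe_image, Set.mem_iUnion,
      Set.mem_image, Finset.mem_coe, exists_prop, exists_exists_and_eq_and]
    have hpre : ∀ j ∈ J, G.s a = G.r t → (G.pre (f j) t ↔ G.pre j (G.mul a t)) := by
      intro j hj ht
      rw [← G.pre_mul_left_iff (hf j hj) ht, hfm j hj]
    constructor
    · rintro ⟨h1, h2⟩
      have ht : G.s a = G.r t := hac.trans (G.r_eq_of_pre h1)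
      obtain ⟨j, hj, hjt⟩ := (key (G.mul a t)).1
        ⟨(G.pre_mul_left_iff hac ht).2 h1, (G.pre_mul_left_iff hae ht).2 h2⟩
      exact ⟨j, hj, (hpre j hj ht).2 hjt⟩
    · rintro ⟨j, hj, hjt⟩
      have ht : G.s a = G.r t := (hf j hj).trans (G.r_eq_of_pre hjt)
      obtain ⟨h1, h2⟩ := (key (G.mul a t)).2 ⟨j, hj, (hpre j hj ht).1 hjt⟩
      exact ⟨(G.pre_mul_left_iff hac ht).1 h1, (G.pre_mul_left_iff hae ht).1 h2⟩
  · refine ⟨∅, Set.ext fun t => ?_⟩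
    simp only [Set.mem_inter_iff, mem_cone_iff_pre, Finset.coe_empty, Set.mem_empty_iff_false,
      Set.iUnion_of_empty, Set.iUnion_empty, iff_false, not_and]
    intro h1 h2
    exact hae (hac.trans ((G.r_eq_of_pre h1).trans (G.r_eq_of_pre h2).symm))

theorem IsFilter.r_eq {x : Set G.Λ} (hx : G.IsFilter x) {a b : G.Λ} (ha : a ∈ x) (hb : b ∈ x) :
    G.r a = G.r b := by
  obtain ⟨l, -, h1, h2⟩ := hx.2.2 a ha b hb
  exact (G.r_eq_of_pre h1).trans (G.r_eq_of_pre h2).symm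

/-- A filter contains at most one path of each degree. -/
theorem IsFilter.eq_of_d_eq {x : Set G.Λ} (hx : G.IsFilter x) {a b : G.Λ} (ha : a ∈ x)
    (hb : b ∈ x) (hd : G.d a = G.d b) : a = b := by
  obtain ⟨l, -, ⟨k, hk, rfl⟩, ⟨k', hk', h⟩⟩ := hx.2.2 a ha b hb
  exact (G.factorisation_unique hk hk' h.symm hd).1

theorem act_eq_lshift {x : Set G.Λ} (hx : G.IsFilter x) {a : G.Λ} (ha : a ∈ x) :
    G.act x (G.d a) = G.lshift a x := by
  ext t
  simp only [act, Set.mem_iUnion, Set.mem_ofPred_eq, exists_prop]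
  constructor
  · rintro ⟨b, ⟨hb, hd⟩, ht⟩
    rwa [← hx.eq_of_d_eq G hb ha hd]
  · exact fun ht => ⟨a, ⟨ha, rfl⟩, ht⟩

/-- Every element of a filter containing `a` lies below an extension of `a` in the filter. -/
theorem IsFilter.exists_extension {x : Set G.Λ} (hx : G.IsFilter x) {a b : G.Λ} (ha : a ∈ x)
    (hb : b ∈ x) : ∃ k ∈ G.lshift a x, G.pre b (G.mul a k) := by
  obtain ⟨l, hl, ⟨k, hk, rfl⟩, h⟩ := hx.2.2 a ha b hb
  exact ⟨k, ⟨hk, hl⟩, h⟩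

theorem s_mem_lshift {x : Set G.Λ} {a : G.Λ} (ha : a ∈ x) : G.s a ∈ G.lshift a x :=
  ⟨(G.r_s a).symm, by rwa [G.mul_id]⟩

theorem IsFilter.lshift {x : Set G.Λ} (hx : G.IsFilter x) {a : G.Λ} (ha : a ∈ x) :
    G.IsFilter (G.lshift a x) := by
  refine ⟨⟨_, G.s_mem_lshift ha⟩, ?_, ?_⟩
  · rintro b c hbc ⟨hc, hcx⟩
    have hb : G.s a = G.r b := hc.trans (G.r_eq_of_pre hbc).symm
    exact ⟨hb, hx.2.1 _ _ ((G.pre_mul_left_iff hb hc).2 hbc) hcx⟩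
  · rintro b ⟨hb, hbx⟩ c ⟨hc, hcx⟩
    obtain ⟨l, hl, h1, h2⟩ := hx.2.2 _ hbx _ hcx
    obtain ⟨k, hk, rfl⟩ := G.pre_trans ⟨b, hb, rfl⟩ h1
    exact ⟨k, ⟨hk, hl⟩, (G.pre_mul_left_iff hb hk).1 h1, (G.pre_mul_left_iff hc hk).1 h2⟩

theorem lshift_mem_PS {x : Set G.Λ} (hx : x ∈ G.PS) {a : G.Λ} (ha : a ∈ x) :
    G.lshift a x ∈ G.PS := by
  obtain ⟨hf, b, hb, hbFA⟩ := hx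
  obtain ⟨k, hk, hbk⟩ := hf.exists_extension G ha hb
  exact ⟨hf.lshift G ha, k, hk,
    FinAlignedAt.of_mul_left G hk.1 (FinAlignedAt.of_pre G hbFA hbk)⟩

theorem rshift_lshift {x : Set G.Λ} (hx : G.IsFilter x) {a : G.Λ} (ha : a ∈ x) :
    G.rshift a (G.lshift a x) = x := by
  ext t
  constructor
  · rintro ⟨k, ⟨-, hk⟩, -, h⟩
    exact hx.2.1 _ _ h hk
  · intro ht
    obtain ⟨k, hk, h⟩ := hx.exists_extension G ha ht
    exact ⟨k, hk, hk.1, h⟩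

theorem lshift_rshift {x : Set G.Λ} (hx : G.IsFilter x) {a : G.Λ} (ha : G.s a ∈ x) :
    G.lshift a (G.rshift a x) = x := by
  ext t
  constructor
  · rintro ⟨ht, k, hk, hak, h⟩
    exact hx.2.1 _ _ ((G.pre_mul_left_iff ht hak).1 h) hk
  · intro ht
    have hat : G.s a = G.r t := by rw [← hx.r_eq G ha ht, G.r_s]
    exact ⟨hat, t, ht, hat, G.s _, (G.r_s _).symm, G.mul_id _⟩

theorem mem_rshift_self {x : Set G.Λ} {a : G.Λ} (ha : G.s a ∈ x) : a ∈ G.rshift a x :=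
  ⟨G.s a, ha, (G.r_s a).symm, G.s a, (G.r_s a).symm, rfl⟩

end PGraph

/-- For `(y,q,z) ∈ PS(Λ) × Q × PS(Λ)` the following are equivalent:
(1) there are `m,n ∈ P` with `q = mn⁻¹`, `y ∈ D_m`, `z ∈ D_n` and `y·m = z·n`;
(2) there are `x ∈ PS(Λ)` and `μ,ν ∈ Λ` with `s(μ) = s(ν) = r(x)` such that
`(y,q,z) = (μ·x, d(μ)d(ν)⁻¹, ν·x)`. -/
theorem statement18 {Q : Type} [Group Q] {W : WQLO Q} (G : PGraph Q W)
    (hne : G.FA.Nonempty) (y z : Set G.Λ) (hy : y ∈ G.PS) (hz : z ∈ G.PS) (q : Q) :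
    (∃ m ∈ W.P, ∃ n ∈ W.P, q = m * n⁻¹ ∧ y ∈ G.Dom m ∧ z ∈ G.Dom n ∧
      G.act y m = G.act z n) ↔
    (∃ x ∈ G.PS, ∃ mu nu : G.Λ, G.s mu ∈ x ∧ G.s nu ∈ x ∧
      y = G.rshift mu x ∧ q = G.d mu * (G.d nu)⁻¹ ∧ z = G.rshift nu x) := by
  constructor
  · rintro ⟨m, -, n, -, rfl, ⟨-, mu, hmu, rfl⟩, ⟨-, nu, hnu, rfl⟩, h⟩
    rw [G.act_eq_lshift hy.1 hmu, G.act_eq_lshift hz.1 hnu] at h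
    refine ⟨G.lshift mu y, G.lshift_mem_PS hy hmu, mu, nu, G.s_mem_lshift hmu, ?_,
      (G.rshift_lshift hy.1 hmu).symm, rfl, ?_⟩
    · rw [h]
      exact G.s_mem_lshift hnu
    · rw [h, G.rshift_lshift hz.1 hnu]
  · rintro ⟨x, hx, mu, nu, hmu, hnu, rfl, rfl, rfl⟩
    have hmu' := G.mem_rshift_self hmu
    have hnu' := G.mem_rshift_self hnu
    refine ⟨G.d mu, G.d_mem mu, G.d nu, G.d_mem nu, rfl, ⟨hy, mu, hmu', rfl⟩,
      ⟨hz, nu, hnu', rfl⟩, ?_⟩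
    rw [G.act_eq_lshift hy.1 hmu', G.act_eq_lshift hz.1 hnu', G.lshift_rshift hx.1 hmu,
      G.lshift_rshift hx.1 hnu]
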